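/- Let π : R → S be a surjective homomorphism of unital QB-rings whose kernel I has stable rank one. If xa + b = 1 in R, x̄ā + b̄ = 1 in S with π(a)=ā, π(b)=b̄, π(x)=x̄, and ȳ ∈ S, ū ∈ S_q^{-1} satisfy ā + ȳb̄ = ū, then there exist y ∈ R and u ∈ R_q^{-1} with π(y)=ȳ, π(u)=ū and a + yb = u. In particular, any inverse limit of a sequence of unital QB-rings along surjective connecting homomorphisms whose kernels all have stable rank one is a QB-ring. -/

import Mathlib

/-- The set of quasi-invertible elements of a unital ring:
`u ∈ qInv R` iff there are `v, w` with `(1-vu) R (1-uw) = 0 = (1-uw) R (1-vu)`. -/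
def qInv (R : Type*) [Ring R] : Set R :=
  {u | ∃ v w : R, (∀ r : R, (1 - v * u) * r * (1 - u * w) = 0) ∧
        (∀ r : R, (1 - u * w) * r * (1 - v * u) = 0)}

/-- A unital ring `R` is a QB-ring if whenever `a x + b = 1` there is `y` with
`a + b y` quasi-invertible. -/
def IsQB (R : Type*) [Ring R] : Prop :=
  ∀ a x b : R, a * x + b = 1 → ∃ y : R, a + b * y ∈ qInv R

/-- The kernel of a (non-unital) ring homomorphism, as a non-unital subring. -/
def krn {R S : Type*} [NonUnitalRing R] [NonUnitalRing S] (π : R →ₙ+* S) :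
    NonUnitalSubring R where
  carrier := {x | π x = 0}
  zero_mem' := by simp
  add_mem' := by intro a b ha hb; simp only [Set.mem_setOf_eq] at *; simp [ha, hb]
  mul_mem' := by intro a b ha hb; simp only [Set.mem_setOf_eq] at *; simp [ha, hb]
  neg_mem' := by intro a ha; simp only [Set.mem_setOf_eq] at *; simp [ha]

/-- A non-unital ring `I` has stable rank one: whenever `(1-x)(1-a) + b = 1` in
the unitalization `I⁺` with `x, a, b ∈ I`, there is `y ∈ I` with `1 - a + y b`
invertible in `I⁺`. -/
def HasStableRankOne (I : Type*) [NonUnitalRing I] : Prop :=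
  ∀ x a b : I,
    ((1 : Unitization ℤ I) - (x : Unitization ℤ I)) * (1 - (a : Unitization ℤ I))
      + (b : Unitization ℤ I) = 1 →
    ∃ y : I, IsUnit ((1 : Unitization ℤ I) - (a : Unitization ℤ I)
      + ((y * b : I) : Unitization ℤ I))

/-- The inverse limit of a sequence of unital rings. -/
def invLim (R : ℕ → Type u) [∀ n, Ring (R n)]
    (π : ∀ n, R (n + 1) →+* R n) : Subring (∀ n, R n) where
  carrier := {x | ∀ n, π n (x (n + 1)) = x n}
  zero_mem' := by intro n; simp
  one_mem' := by intro n; simp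
  add_mem' := by intro a b ha hb n; simp [ha n, hb n]
  mul_mem' := by intro a b ha hb n; simp [ha n, hb n]
  neg_mem' := by intro a ha n; simp [ha n]

def QI {R : Type*} [Ring R] (u v : R) : Prop :=
  u * v * u = u ∧ v * u * v = v ∧ (∀ r : R, (1 - v * u) * r * (1 - u * v) = 0) ∧
    (∀ r : R, (1 - u * v) * r * (1 - v * u) = 0)

theorem QI.mem {R : Type*} [Ring R] {u v : R} (h : QI u v) : u ∈ qInv R :=
  ⟨v, v, h.2.2.1, h.2.2.2⟩

theorem exists_QI {R : Type*} [Ring R] {u : R} (h : u ∈ qInv R) : ∃ v, QI u v := by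
  obtain ⟨v, w, h1, h2⟩ := h
  have e0 : (1 - u * w) * u * (1 - v * u) = 0 := h2 u
  have key : u * (w + v - w * u * v) * u = u := by
    have : u * (w + v - w * u * v) * u = u - (1 - u * w) * u * (1 - v * u) := by noncomm_ring
    rw [this, e0, sub_zero]
  generalize ht : w + v - w * u * v = t at key
  have a1 : 1 - t * u = (1 - w * u) * (1 - v * u) := by rw [← ht]; noncomm_ring
  have a2 : 1 - u * t = (1 - u * w) * (1 - u * v) := by rw [← ht]; noncomm_ring
  have b1 : t * u * t * u = t * u := by rw [mul_assoc, mul_assoc, ← mul_assoc u, key]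
  have b2 : u * (t * u * t) = u * t := by rw [← mul_assoc, ← mul_assoc, key]
  refine ⟨t * u * t, ?_, ?_, ?_, ?_⟩
  · rw [b2, key]
  · rw [b1, ← mul_assoc, ← mul_assoc, b1]
  · intro r
    rw [b1, b2, a1, a2]
    have := h1 r
    calc _ = (1 - w * u) * ((1 - v * u) * r * (1 - u * w)) * (1 - u * v) := by
          simp only [mul_assoc]
      _ = 0 := by rw [this]; simp
  · intro r
    rw [b1, b2, a1, a2]
    have := h2 ((1 - u * v) * r * (1 - w * u))
    rw [← this]; simp only [mul_assoc]

theorem qInv_units {R : Type*} [Ring R] {u : R} (h : u ∈ qInv R) (g k : Rˣ) :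
    (g : R) * u * k ∈ qInv R := by
  obtain ⟨v, w, h1, h2⟩ := h
  have c1 : ∀ v : R, 1 - (↑k⁻¹ * v * ↑g⁻¹) * (↑g * u * ↑k) = (↑k⁻¹ : R) * (1 - v * u) * k := by
    intro v
    simp [mul_sub, sub_mul, mul_assoc]
  have c2 : ∀ v : R, 1 - (↑g * u * ↑k) * (↑k⁻¹ * v * ↑g⁻¹) = (g : R) * (1 - u * v) * ↑g⁻¹ := by
    intro v
    simp [mul_sub, sub_mul, mul_assoc]
  refine ⟨↑k⁻¹ * v * ↑g⁻¹, ↑k⁻¹ * w * ↑g⁻¹, ?_, ?_⟩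
  · intro r
    rw [c1, c2]
    calc _ = (↑k⁻¹ : R) * ((1 - v * u) * (k * r * g) * (1 - u * w)) * ↑g⁻¹ := by
          simp only [mul_assoc]
      _ = 0 := by rw [h1]; simp
  · intro r
    rw [c1, c2]
    calc _ = (g : R) * ((1 - u * w) * (↑g⁻¹ * r * ↑k⁻¹) * (1 - v * u)) * k := by
          simp only [mul_assoc]
      _ = 0 := by rw [h2]; simp

theorem qInv_add {R : Type*} [Ring R] {u v p : R} (j : R) (hu : u ∈ qInv R)
    (hvp : v * p = 0) (hj : p * j * (1 - v * u) = 0) : u + p * j ∈ qInv R := by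
  have hn : p * j * v * (p * j * v) = 0 := by
    calc _ = p * j * (v * p) * j * v := by simp only [mul_assoc]
      _ = 0 := by rw [hvp]; simp
  let g : Rˣ := ⟨1 + p * j * v, 1 - p * j * v,
    by calc _ = 1 - p * j * v * (p * j * v) := by noncomm_ring
         _ = 1 := by rw [hn, sub_zero],
    by calc _ = 1 - p * j * v * (p * j * v) := by noncomm_ring
         _ = 1 := by rw [hn, sub_zero]⟩
  have := qInv_units hu g 1
  have e : (g : R) * u * ((1 : Rˣ) : R) = u + p * j := by
    show (1 + p * j * v) * u * 1 = _
    calc _ = u + p * j - p * j * (1 - v * u) := by noncomm_ring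
      _ = _ := by rw [hj, sub_zero]
  rwa [e] at this

/-- Stable rank one of the kernel, read in `R`. -/
def SR {R S : Type*} [Ring R] [Ring S] (π : R →+* S) : Prop :=
  ∀ x a b : R, π x = 1 → π a = 1 → x * a + b = 1 → ∃ y, π y = 0 ∧ IsUnit (a + y * b)

theorem unitization_isUnit {I R : Type*} [NonUnitalRing I] [Ring R] (φ : I →ₙ+* R)
    (t : Unitization ℤ I) (ht : IsUnit t) : IsUnit ((t.fst : R) + φ t.snd) := by
  have hm : ∀ s t : Unitization ℤ I, ((s * t).fst : R) + φ (s * t).snd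
      = ((s.fst : R) + φ s.snd) * ((t.fst : R) + φ t.snd) := by
    intro s t
    rw [Unitization.fst_mul, Unitization.snd_mul]
    simp only [map_add, map_mul, map_zsmul, zsmul_eq_mul, Int.cast_mul, add_mul, mul_add]
    rw [(Int.cast_commute t.fst (φ s.snd)).eq]
    abel
  have h1 : (((1 : Unitization ℤ I).fst : ℤ) : R) + φ (1 : Unitization ℤ I).snd = 1 := by
    simp
  obtain ⟨g, rfl⟩ := ht
  refine ⟨⟨_, ((g⁻¹).val.fst : R) + φ (g⁻¹).val.snd, ?_, ?_⟩, rfl⟩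
  · rw [← hm, Units.mul_inv, h1]
  · rw [← hm, Units.inv_mul, h1]

theorem sr_of {R S : Type*} [Ring R] [Ring S] (π : R →+* S)
    (h : HasStableRankOne ↥(krn π.toNonUnitalRingHom)) : SR π := by
  intro x a b hx ha hb
  have hb' : π b = 0 := by
    have := congrArg π hb
    simpa [hx, ha] using this
  let x' : ↥(krn π.toNonUnitalRingHom) := ⟨1 - x, show π (1 - x) = 0 by simp [hx]⟩
  let a' : ↥(krn π.toNonUnitalRingHom) := ⟨1 - a, show π (1 - a) = 0 by simp [ha]⟩
  let b' : ↥(krn π.toNonUnitalRingHom) := ⟨b, hb'⟩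
  have hz : x' * a' + b' - x' - a' = 0 := by
    apply Subtype.ext
    show (1 - x) * (1 - a) + b - (1 - x) - (1 - a) = 0
    calc _ = x * a + b - 1 := by noncomm_ring
      _ = 0 := by rw [hb, sub_self]
  obtain ⟨y, hy⟩ := h x' a' b' (by
    have := congrArg (Unitization.inr (R := ℤ)) hz
    simp only [Unitization.inr_sub, Unitization.inr_add, Unitization.inr_mul, Unitization.inr_zero] at this
    calc _ = 1 + ((x' : Unitization ℤ ↥(krn π.toNonUnitalRingHom)) * a' + b' - x' - a') := by noncomm_ring
      _ = 1 := by rw [this, add_zero])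
  refine ⟨y, y.2, ?_⟩
  have := unitization_isUnit (NonUnitalSubringClass.subtype (krn π.toNonUnitalRingHom)) _ hy
  have e : (((1 - Unitization.inr a' + Unitization.inr (y * b') :
      Unitization ℤ ↥(krn π.toNonUnitalRingHom)).fst : ℤ) : R)
      + (NonUnitalSubringClass.subtype (krn π.toNonUnitalRingHom))
        (1 - Unitization.inr a' + Unitization.inr (y * b') :
      Unitization ℤ ↥(krn π.toNonUnitalRingHom)).snd = a + y * b := by
    have e1 : (1 - Unitization.inr a' + Unitization.inr (y * b') :
      Unitization ℤ ↥(krn π.toNonUnitalRingHom)).fst = 1 := by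
      show (1 : ℤ) - 0 + 0 = 1
      norm_num
    have e2 : (1 - Unitization.inr a' + Unitization.inr (y * b') :
      Unitization ℤ ↥(krn π.toNonUnitalRingHom)).snd = 0 - a' + y * b' := rfl
    rw [e1, e2]
    show ((1 : ℤ) : R) + (0 - (1 - a) + y * b) = _
    rw [Int.cast_one]; noncomm_ring
  rwa [e] at this

/-- Left-right symmetry of stable rank one. -/
theorem sr_symm {R S : Type*} [Ring R] [Ring S] (π : R →+* S) (h : SR π)
    (x a b : R) (hx : π x = 1) (ha : π a = 1) (hb : a * x + b = 1) :
    ∃ y, π y = 0 ∧ IsUnit (a + b * y) := by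
  obtain ⟨z, hz, d, hd⟩ := h x a (1 - x * a) hx ha (by noncomm_ring)
  refine ⟨z, hz, ?_⟩
  have hb2 : b = 1 - a * x := by rw [← hb]; noncomm_ring
  have r1 : (a + b * z) * (1 - x * a) = b * d := by
    rw [hd, hb2]; noncomm_ring
  have r2 : (1 - z * x) * (a + b * z) = d * (1 - x * z) := by
    rw [hd, hb2]; noncomm_ring
  refine ⟨⟨a + b * z, x + (1 - x * a) * ↑d⁻¹ * (1 - z * x), ?_, ?_⟩, rfl⟩
  · calc _ = (a + b * z) * x + ((a + b * z) * (1 - x * a)) * ↑d⁻¹ * (1 - z * x) := by noncomm_ring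
      _ = 1 := by
        rw [r1, mul_assoc b, Units.mul_inv, hb2]; noncomm_ring
  · calc _ = x * (a + b * z) + (1 - x * a) * ↑d⁻¹ * ((1 - z * x) * (a + b * z)) := by noncomm_ring
      _ = x * (a + b * z) + (1 - x * a) * (↑d⁻¹ * d) * (1 - x * z) := by
        rw [r2]; simp only [mul_assoc]
      _ = 1 := by
        rw [Units.inv_mul, hb2]; noncomm_ring

/-- Quasi-invertibles lift. -/
theorem lift_qInv {R S : Type*} [Ring R] [Ring S] (π : R →+* S)
    (hπ : Function.Surjective π) (hR : IsQB R) (h : SR π) {ub : S} (hu : ub ∈ qInv S) :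
    ∃ w ∈ qInv R, π w = ub := by
  obtain ⟨vb, g1, g2, g3, g4⟩ := exists_QI hu
  obtain ⟨a, rfl⟩ := hπ ub
  obtain ⟨v, rfl⟩ := hπ vb
  obtain ⟨y, hy⟩ := hR a v (1 - a * v) (by noncomm_ring)
  obtain ⟨t, ht⟩ : ∃ t, t = 1 - a * v := ⟨_, rfl⟩
  obtain ⟨s, hs⟩ : ∃ s, s = y * v := ⟨_, rfl⟩
  have hst : π (s * t) = 0 := by
    rw [hs, ht]
    have : y * v * (1 - a * v) = y * (v - v * a * v) := by noncomm_ring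
    rw [this]; simp [g2]
  obtain ⟨z, hz, hzu⟩ := h (1 - s * t) (1 + s * t) (s * t * (s * t)) (by rw [map_sub, hst]; simp)
    (by rw [map_add, hst]; simp) (by noncomm_ring)
  obtain ⟨s', hs'⟩ : ∃ s', s' = s + z * (s * t) * s := ⟨_, rfl⟩
  have e1 : 1 + s * t + z * (s * t * (s * t)) = 1 + s' * t := by rw [hs']; noncomm_ring
  rw [e1] at hzu
  obtain ⟨k, hk⟩ := hzu
  have hk1 : (1 + s' * t) * ↑k⁻¹ = 1 := by rw [← hk]; simp
  have hk2 : ↑k⁻¹ * (1 + s' * t) = 1 := by rw [← hk]; simp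
  let g : Rˣ := ⟨1 + t * s', 1 - t * ↑k⁻¹ * s',
    by calc _ = 1 + t * s' - t * ((1 + s' * t) * ↑k⁻¹) * s' := by noncomm_ring
         _ = 1 := by rw [hk1]; noncomm_ring,
    by calc _ = 1 + t * s' - t * (↑k⁻¹ * (1 + s' * t)) * s' := by noncomm_ring
         _ = 1 := by rw [hk2]; noncomm_ring⟩
  refine ⟨↑g⁻¹ * (a + t * y) * ((1 : Rˣ) : R), qInv_units (by rw [ht]; exact hy) g⁻¹ 1, ?_⟩
  have e2 : π (a + t * y) = π (g * a) := by
    have e3 : π s' = π s := by rw [hs', map_add, map_mul, map_mul, hz]; simp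
    have e4 := g4 (π y)
    show _ = π ((1 + t * s') * a)
    rw [map_mul, map_add (f := π) (x := 1), map_mul, e3, hs, ht]
    simp only [map_add, map_sub, map_mul, map_one]
    rw [← sub_eq_zero, ← e4]
    noncomm_ring
  rw [map_mul, map_mul, e2, ← map_mul, ← mul_assoc]
  simp

/-- The correction step. -/
theorem correct {R S : Type*} [Ring R] [Ring S] (π : R →+* S) (h : SR π)
    {w a x b : R} (hw : w ∈ qInv R) (hwa : π w = π a) (h1 : x * a + b = 1) :
    ∃ z, π z = 0 ∧ a + z * b ∈ qInv R := by
  obtain ⟨v, g1, g2, g3, g4⟩ := exists_QI hw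
  obtain ⟨i, hi⟩ : ∃ i, i = a - w := ⟨_, rfl⟩
  have hπi : π i = 0 := by rw [hi, map_sub, hwa, sub_self]
  have ha : a = w + i := by rw [hi]; noncomm_ring
  obtain ⟨p, hp⟩ : ∃ p, p = 1 - w * v := ⟨_, rfl⟩
  obtain ⟨y, hy, g, hg⟩ := h (1 - v * i + v * i * (v * i) * x * w) (1 + v * i)
    (v * i * (v * i) * (x * p * i + b)) (by simp [hπi]) (by simp [hπi]) (by
      have hb : b = 1 - x * (w + i) := by rw [← ha, ← h1]; noncomm_ring
      rw [hb, hp]; noncomm_ring)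
  obtain ⟨m, hm⟩ : ∃ m, m = y * (v * i * (v * i)) := ⟨_, rfl⟩
  have hπm : π m = 0 := by rw [hm, map_mul, hy, zero_mul]
  obtain ⟨k, hk⟩ : ∃ k, k = m * x := ⟨_, rfl⟩
  have hg' : (g : R) = 1 + (v + k * p) * i + m * b := by
    rw [hg, hk, hm]; noncomm_ring
  refine ⟨w * m, by rw [map_mul, hπm, mul_zero], ?_⟩
  have e1 : a + w * m * b = (w + (1 - w * k) * p * (i * ↑g⁻¹)) * g := by
    rw [add_mul, mul_assoc _ (i * _), mul_assoc i, Units.inv_mul, hg', ha, hp]; noncomm_ring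
  rw [e1]
  have hvp : v * p = 0 := by
    rw [hp]; calc _ = v - v * w * v := by noncomm_ring
      _ = 0 := by rw [g2, sub_self]
  have hpw : p * w = 0 := by
    rw [hp]; calc _ = w - w * v * w := by noncomm_ring
      _ = 0 := by rw [g1, sub_self]
  have hqp : (1 - v * w) * k * p = 0 := by rw [hp]; exact g3 k
  have hpq : ∀ r, p * r * (1 - v * w) = 0 := by rw [hp]; exact g4
  have := qInv_add (u := w) (v := v + k * p) (p := (1 - w * k) * p) (i * ↑g⁻¹) hw (by
      have : (v + k * p) * ((1 - w * k) * p)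
        = v * p + (1 - v * w) * k * p - k * p + k * p * p - k * (p * w) * k * p := by noncomm_ring
      rw [this, hvp, hqp, hpw]
      have hpp : p * p = p := by
        calc p * p = p * (1 - w * v) := by rw [← hp]
          _ = p - p * w * v := by noncomm_ring
          _ = p := by rw [hpw]; simp
      rw [mul_assoc k, hpp]; noncomm_ring) (by
      have : (1 - w * k) * p * (i * ↑g⁻¹) * (1 - (v + k * p) * w)
        = (1 - w * k) * (p * (i * ↑g⁻¹) * (1 - v * w))
          - (1 - w * k) * p * (i * ↑g⁻¹) * k * (p * w) := by noncomm_ring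
      rw [this, hpq, hpw]; simp)
  have := qInv_units this 1 g
  simpa using this

theorem part1 {R S : Type*} [Ring R] [Ring S] (π : R →+* S)
    (hπ : Function.Surjective π) (h : SR π)
    (hl : ∀ ub ∈ qInv S, ∃ w ∈ qInv R, π w = ub)
    (x a b : R) (h1 : x * a + b = 1)
    (yb : S) (hu : π a + yb * π b ∈ qInv S) :
    ∃ y : R, π y = yb ∧ a + y * b ∈ qInv R := by
  obtain ⟨y, rfl⟩ := hπ yb
  obtain ⟨w, hw, hwu⟩ := hl _ hu
  obtain ⟨z, hz, hq⟩ := correct π h (w := w) (a := a + y * b) (x := x) (b := (1 - x * y) * b) hw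
    (by rw [hwu]; simp) (by
      calc _ = x * a + b := by noncomm_ring
        _ = 1 := h1)
  refine ⟨y + z * (1 - x * y), by simp [hz], ?_⟩
  convert hq using 1
  noncomm_ring

open MulOpposite in
theorem qInv_op {R : Type*} [Ring R] {u : R} (h : u ∈ qInv R) : op u ∈ qInv Rᵐᵒᵖ := by
  obtain ⟨v, w, h1, h2⟩ := h
  refine ⟨op w, op v, fun r => ?_, fun r => ?_⟩
  · apply unop_injective
    simpa [mul_assoc] using h1 (unop r)
  · apply unop_injective
    simpa [mul_assoc] using h2 (unop r)

open MulOpposite in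
theorem qInv_unop {R : Type*} [Ring R] {u : Rᵐᵒᵖ} (h : u ∈ qInv Rᵐᵒᵖ) : unop u ∈ qInv R := by
  obtain ⟨v, w, h1, h2⟩ := h
  refine ⟨unop w, unop v, fun r => ?_, fun r => ?_⟩
  · apply op_injective
    simpa [mul_assoc] using h1 (op r)
  · apply op_injective
    simpa [mul_assoc] using h2 (op r)

open MulOpposite in
theorem part1_op {R S : Type*} [Ring R] [Ring S] (π : R →+* S)
    (hπ : Function.Surjective π) (h : SR π)
    (hl : ∀ ub ∈ qInv S, ∃ w ∈ qInv R, π w = ub)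
    (x a b : R) (h1 : a * x + b = 1)
    (yb : S) (hu : π a + π b * yb ∈ qInv S) :
    ∃ y : R, π y = yb ∧ a + b * y ∈ qInv R := by
  have hop : SR (RingHom.op π) := by
    intro x a b hx ha hb
    obtain ⟨y, hy, hy'⟩ := sr_symm π h (unop x) (unop a) (unop b)
      (op_injective (by simpa using hx)) (op_injective (by simpa using ha))
      (op_injective (by simpa using hb))
    refine ⟨op y, by simp [hy], ?_⟩
    have := hy'.op
    simpa using this
  obtain ⟨y, hy, hy'⟩ := part1 (RingHom.op π)
    (fun s => by obtain ⟨r, hr⟩ := hπ (unop s); exact ⟨op r, by simp [hr]⟩) hop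
    (fun ub hub => by
      obtain ⟨w, hw, hw'⟩ := hl _ (qInv_unop hub)
      exact ⟨op w, qInv_op hw, by simp [hw']⟩)
    (op x) (op a) (op b) (unop_injective (by simpa using h1)) (op yb)
    (by simpa using qInv_op hu)
  refine ⟨unop y, op_injective (by simpa using hy), ?_⟩
  simpa using qInv_unop hy'

theorem lift_inner {R S : Type*} [Ring R] [Ring S] (π : R →+* S)
    (hπ : Function.Surjective π) {u : R} (hu : u ∈ qInv R) {vb : S} (hv : QI (π u) vb) :
    ∃ v, π v = vb ∧ QI u v := by
  obtain ⟨v0, k1, k2, k3, k4⟩ := exists_QI hu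
  obtain ⟨v1, rfl⟩ := hπ vb
  obtain ⟨g1, g2, -, -⟩ := hv
  have k2' := congrArg π k2
  simp only [map_mul] at k2'
  obtain ⟨t, ht⟩ : ∃ t, t = v1 + v0 - v0 * (u * v1 * u) * v0 := ⟨_, rfl⟩
  have t1 : u * t * u = u := by
    have : u * t * u = u * v1 * u + u * v0 * u - (u * v0 * u) * v1 * (u * v0 * u) := by
      rw [ht]; noncomm_ring
    rw [this, k1]; noncomm_ring
  have t2 : π t = π v1 := by
    rw [ht]; simp only [map_add, map_sub, map_mul]
    rw [g1, k2']; noncomm_ring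
  have b1 : t * u * t * u = t * u := by rw [mul_assoc, mul_assoc, ← mul_assoc u, t1]
  have b2 : u * (t * u * t) = u * t := by rw [← mul_assoc, ← mul_assoc, t1]
  have c1 : 1 - t * u = (1 - v0 * u) * (1 - t * u) := by
    have : (1 - v0 * u) * (1 - t * u) = 1 - t * u - v0 * u + v0 * (u * t * u) := by noncomm_ring
    rw [this, t1]; noncomm_ring
  have c2 : 1 - u * t = (1 - u * t) * (1 - u * v0) := by
    have : (1 - u * t) * (1 - u * v0) = 1 - u * t - u * v0 + (u * t * u) * v0 := by noncomm_ring
    rw [this, t1]; noncomm_ring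
  have c1' : 1 - t * u = (1 - t * u) * (1 - t * u) := by
    have : (1 - t * u) * (1 - t * u) = 1 - t * u - t * u + t * u * t * u := by noncomm_ring
    rw [this, b1]; noncomm_ring
  refine ⟨t * u * t, ?_, ?_, ?_, ?_, ?_⟩
  · simp only [map_mul, t2, g2]
  · rw [b2, t1]
  · rw [b1, ← mul_assoc, ← mul_assoc, b1]
  · intro r
    rw [b1, b2, c1, c2, ← k3 ((1 - t * u) * r * (1 - u * t))]
    simp only [mul_assoc]
  · intro r
    rw [b1, b2, c1, c2]
    have := k4 (r)
    calc _ = (1 - u * t) * ((1 - u * v0) * r * (1 - v0 * u)) * (1 - t * u) := by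
          simp only [mul_assoc]
      _ = 0 := by rw [this]; simp

theorem part2 (A : ℕ → Type*) [inst : ∀ n, Ring (A n)] (p : ∀ n, A (n + 1) →+* A n)
    (hs : ∀ n, Function.Surjective (p n)) (hq : ∀ n, IsQB (A n))
    (hk : ∀ n, SR (p n)) : IsQB ↥(invLim A p) := by
  intro a x b hab
  have hab' : ∀ n, a.1 n * x.1 n + b.1 n = 1 := fun n => congrFun (congrArg Subtype.val hab) n
  let T : ℕ → Type _ := fun n => {c : A n × A n // QI (a.1 n + b.1 n * c.1) c.2}
  have h0 : Nonempty (T 0) := by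
    obtain ⟨y, hy⟩ := hq 0 _ _ _ (hab' 0)
    obtain ⟨v, hv⟩ := exists_QI hy
    exact ⟨⟨(y, v), hv⟩⟩
  have hstep : ∀ n (c : T n), ∃ d : T (n + 1), p n d.1.1 = c.1.1 ∧ p n d.1.2 = c.1.2 := by
    intro n ⟨⟨y, v⟩, hyv⟩
    have ea := a.2 n
    have eb := b.2 n
    simp only at hyv
    rw [← ea, ← eb] at hyv
    obtain ⟨y', hy', hu⟩ := part1_op (p n) (hs n) (hk n)
      (fun ub hub => lift_qInv (p n) (hs n) (hq (n + 1)) (hk n) hub) _ _ _ (hab' (n + 1)) y hyv.mem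
    obtain ⟨v', hv', hv''⟩ := lift_inner (p n) (hs n) hu (vb := v) (by
      rw [map_add, map_mul, hy']; exact hyv)
    exact ⟨⟨(y', v'), hv''⟩, hy', hv'⟩
  choose f hf1 hf2 using hstep
  let c : ∀ n, T n := fun n => Nat.rec h0.some (fun n d => f n d) n
  let y : ↥(invLim A p) := ⟨fun n => (c n).1.1, fun n => hf1 n (c n)⟩
  let v : ↥(invLim A p) := ⟨fun n => (c n).1.2, fun n => hf2 n (c n)⟩
  refine ⟨y, v, v, fun r => ?_, fun r => ?_⟩
  · apply Subtype.ext
    funext n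
    exact (c n).2.2.2.1 (r.1 n)
  · apply Subtype.ext
    funext n
    exact (c n).2.2.2.2 (r.1 n)

/-- Lifting of quasi-invertible reductions along a surjective morphism of unital
QB-rings whose kernel has stable rank one; in particular, a surjective inverse
limit of unital QB-rings with stable-rank-one kernels is a QB-ring. -/
theorem stmt8 {R S : Type u} [Ring R] [Ring S] (π : R →+* S)
    (hπ : Function.Surjective π) (hR : IsQB R) (hS : IsQB S)
    (hker : HasStableRankOne ↥(krn π.toNonUnitalRingHom))
    (x a b : R) (h1 : x * a + b = 1)
    (h1' : π x * π a + π b = 1)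
    (yb ub : S) (hu : ub ∈ qInv S) (h2 : π a + yb * π b = ub) :
    (∃ y u : R, π y = yb ∧ π u = ub ∧ u ∈ qInv R ∧ a + y * b = u) ∧
    (∀ (A : ℕ → Type u) [inst : ∀ n, Ring (A n)] (p : ∀ n, A (n + 1) →+* A n),
      (∀ n, Function.Surjective (p n)) →
      (∀ n, IsQB (A n)) →
      (∀ n, HasStableRankOne ↥(krn (p n).toNonUnitalRingHom)) →
      IsQB ↥(invLim A p)) := by
  refine ⟨?_, fun A inst p hs hq hk => part2 A p hs hq (fun n => sr_of (p n) (hk n))⟩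
  subst h2
  obtain ⟨y, hy, hq⟩ := part1 π hπ (sr_of π hker)
    (fun ub hub => lift_qInv π hπ hR (sr_of π hker) hub) x a b h1 yb hu
  exact ⟨y, a + y * b, hy, by rw [map_add, map_mul, hy], hq, rfl⟩
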